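/- arXiv:2009.13152 — 2 statements merged into one kernel-verified Lean document; each statement's English description precedes it below -/
import Mathlib

section
/- Let (S, Σ, κ) be a stochastic transition system, let B ∈ Σ, let 𝒜 = (A₀,…,A_n) be a finite sequence of measurable subsets of S, and suppose there exists a real number p > 0 such that for every initial distribution ν on S for which the conditional distribution ν_𝒜 is well-defined, P_{ν_𝒜}(F B) ≥ p. Then for every initial distribution μ on S, P_μ(G (S∖B) ∩ GF φ_𝒜) = 0; that is, almost surely, no run avoids B forever while the pattern A₀,…,A_n occurs at infinitely many positions. -/
open MeasureTheory ProbabilityTheory Filter Set Topology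

/-- Prepend one state to an infinite run. -/
def prep {S : Type*} (s : S) (ρ : ℕ → S) : ℕ → S
  | 0 => s
  | n + 1 => ρ n

/-- Prepend a finite word to an infinite run. -/
def prepList {S : Type*} (l : List S) (ρ : ℕ → S) : ℕ → S := fun n =>
  if h : n < l.length then l.get ⟨n, h⟩ else ρ (n - l.length)

/-- `E` is a tail event: membership is not affected by changing a finite prefix. -/
def IsTailEvent {S : Type*} (E : Set (ℕ → S)) : Prop :=
  ∀ (l : List S) (ρ : ℕ → S), ρ ∈ E ↔ prepList l ρ ∈ E

/-- Cylinder `Cyl A n = {ρ | ρ k ∈ A k for all k < n}` (built from `A 0, …, A (n-1)`). -/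
def Cyl {S : Type*} (A : ℕ → Set S) (n : ℕ) : Set (ℕ → S) := {ρ | ∀ k < n, ρ k ∈ A k}

/-- Event `F B`: eventually reach `B`. -/
def FEv {S : Type*} (B : Set S) : Set (ℕ → S) := {ρ | ∃ n, ρ n ∈ B}

/-- Event `F^{≤ m} B`: reach `B` within `m` steps. -/
def FleEv {S : Type*} (m : ℕ) (B : Set S) : Set (ℕ → S) := {ρ | ∃ n ≤ m, ρ n ∈ B}

/-- Event `G B`: always in `B`. -/
def GEv {S : Type*} (B : Set S) : Set (ℕ → S) := {ρ | ∀ n, ρ n ∈ B}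

/-- Event `GF B`: visit `B` infinitely often. -/
def GFEv {S : Type*} (B : Set S) : Set (ℕ → S) := {ρ | ∀ i, ∃ j ≥ i, ρ j ∈ B}

/-- Event `FG B`: eventually always in `B`. -/
def FGEv {S : Type*} (B : Set S) : Set (ℕ → S) := {ρ | ∃ i, ∀ j ≥ i, ρ j ∈ B}

/-- Event `GF φ_𝒜`: the pattern `A 0, …, A n` occurs at infinitely many positions. -/
def GFPat {S : Type*} (A : ℕ → Set S) (n : ℕ) : Set (ℕ → S) :=
  {ρ | ∀ i, ∃ j ≥ i, ∀ k ≤ n, ρ (j + k) ∈ A k}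

/-- Event `A U B`. -/
def UntilEv {S : Type*} (A B : Set S) : Set (ℕ → S) :=
  {ρ | ∃ n, ρ n ∈ B ∧ ∀ k < n, ρ k ∈ A}

/-- Event `A U^{≤ m} B`. -/
def UntilLeEv {S : Type*} (m : ℕ) (A B : Set S) : Set (ℕ → S) :=
  {ρ | ∃ n ≤ m, ρ n ∈ B ∧ ∀ k < n, ρ k ∈ A}

/-- The filtration `F n`: σ-algebra generated by the cylinders of length `n`,
i.e., by the first `n` coordinates. -/
def cylFiltration (S : Type*) [MeasurableSpace S] (n : ℕ) : MeasurableSpace (ℕ → S) :=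
  MeasurableSpace.comap (fun ρ (i : Fin n) => ρ i) inferInstance

/-- `P` is the family of path measures of the STS `(S, Σ, κ)` given by the
Ionescu–Tulcea construction: for every initial probability distribution `μ`,
`P μ` is a probability measure on runs, and `P` satisfies the Markov property
(`s₀ ∼ μ`, and the rest of the run follows the chain started in `κ s₀`),
which uniquely characterizes the Ionescu–Tulcea path measures. -/
def IsPathMeasure {S : Type*} [MeasurableSpace S] (κ : Kernel S S)
    (P : Measure S → Measure (ℕ → S)) : Prop :=
  (∀ μ : Measure S, IsProbabilityMeasure μ → IsProbabilityMeasure (P μ)) ∧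
  (∀ μ : Measure S, IsProbabilityMeasure μ →
    P μ = μ.bind fun s => (P (κ s)).map (prep s))

/-- `B̃`: the set of states from which `B` is reached with probability zero. -/
def Btilde {S : Type*} [MeasurableSpace S] (P : Measure S → Measure (ℕ → S)) (B : Set S) :
    Set S := {s | P (Measure.dirac s) (FEv B) = 0}

/-- The STS with path measures `P` is decisive w.r.t. `B`. -/
def Decisive {S : Type*} [MeasurableSpace S] (P : Measure S → Measure (ℕ → S)) (B : Set S) :
    Prop := ∀ μ : Measure S, IsProbabilityMeasure μ → P μ (FEv B ∪ FEv (Btilde P B)) = 1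

/-- `ν_{A₀,…,Aₙ}`: the distribution of the `n`-th state under `P ν` conditioned on
the cylinder `Cyl A (n+1)`. -/
noncomputable def condDist {S : Type*} [MeasurableSpace S]
    (P : Measure S → Measure (ℕ → S)) (ν : Measure S) (A : ℕ → Set S) (n : ℕ) : Measure S :=
  (ProbabilityTheory.cond (P ν) (Cyl A (n + 1))).map fun ρ => ρ n

section PathMeasure

variable {S : Type*}

/-- The run that remains after its first `j` states have been dropped. -/
def shiftRun (j : ℕ) (ρ : ℕ → S) : ℕ → S := fun i => ρ (i + j)

/-- Membership in `K` depends only on the states at positions `≤ j`. -/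
def DeterminedBy (j : ℕ) (K : Set (ℕ → S)) : Prop :=
  ∀ ρ ρ' : ℕ → S, (∀ i ≤ j, ρ i = ρ' i) → ρ ∈ K → ρ' ∈ K

lemma DeterminedBy.prep_preimage {j : ℕ} {K : Set (ℕ → S)} (hK : DeterminedBy (j + 1) K) (s : S) :
    DeterminedBy j (prep s ⁻¹' K) := by
  intro ρ ρ' h hρ
  refine hK _ _ ?_ hρ
  rintro (_ | i) hi
  · rfl
  · exact h i (by omega)

lemma determinedBy_cyl (A : ℕ → Set S) (n : ℕ) : DeterminedBy n (Cyl A (n + 1)) := by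
  intro ρ ρ' h hρ k hk
  rw [← h k (by omega)]
  exact hρ k hk

lemma prep_preimage_cyl_succ (A : ℕ → Set S) (n : ℕ) (s : S) :
    prep s ⁻¹' Cyl A (n + 1) = {_ρ | s ∈ A 0} ∩ Cyl (fun k => A (k + 1)) n := by
  ext ρ
  constructor
  · intro h
    exact ⟨h 0 (by omega), fun k hk => h (k + 1) (by omega)⟩
  · rintro ⟨h0, h⟩ (_ | k) hk
    · exact h0
    · exact h k (by omega)

/-- A pattern that occurs infinitely often does so along one of the residue classes modulo
`n + 1`. -/
lemma gfPat_subset_iUnion (A : ℕ → Set S) (n : ℕ) :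
    GFPat A n ⊆ ⋃ r : ℕ, {ρ | ∀ i, ∃ m ≥ i, shiftRun (r + m * (n + 1)) ρ ∈ Cyl A (n + 1)} := by
  intro ρ hρ
  by_contra h
  simp only [mem_iUnion, mem_ofPred_eq] at h
  push Not at h
  choose N hN using h
  obtain ⟨j, hj, hpat⟩ := hρ (∑ r ∈ Finset.range (n + 1), (r + N r * (n + 1)))
  have hr : j % (n + 1) < n + 1 := Nat.mod_lt _ n.succ_pos
  have hle : j % (n + 1) + N (j % (n + 1)) * (n + 1) ≤ j :=
    (Finset.single_le_sum (f := fun r => r + N r * (n + 1)) (fun _ _ => Nat.zero_le _)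
      (Finset.mem_range.2 hr)).trans hj
  have hdiv : j % (n + 1) + j / (n + 1) * (n + 1) = j := Nat.mod_add_div' j (n + 1)
  have hm : N (j % (n + 1)) ≤ j / (n + 1) :=
    Nat.le_of_mul_le_mul_right (by omega : _ * (n + 1) ≤ _ * (n + 1)) n.succ_pos
  refine hN _ _ hm fun k hk => ?_
  rw [hdiv, shiftRun, add_comm]
  exact hpat k (by omega)

variable [MeasurableSpace S]

lemma measurable_prep : Measurable fun x : S × (ℕ → S) => prep x.1 x.2 := by
  refine measurable_pi_lambda _ fun i => ?_
  cases i with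
  | zero => exact measurable_fst
  | succ i => exact (measurable_pi_apply i).comp measurable_snd

lemma measurable_prep_right (s : S) : Measurable (prep s) :=
  measurable_prep.comp measurable_prodMk_left

lemma measurable_shiftRun (j : ℕ) : Measurable (shiftRun (S := S) j) :=
  measurable_pi_lambda _ fun i => measurable_pi_apply (i + j)

lemma measurableSet_cyl {A : ℕ → Set S} {n : ℕ} (hA : ∀ k < n, MeasurableSet (A k)) :
    MeasurableSet (Cyl A n) := by
  have : Cyl A n = ⋂ k, ⋂ (_ : k < n), (fun ρ : ℕ → S => ρ k) ⁻¹' A k := by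
    ext ρ; simp [Cyl]
  rw [this]
  exact .iInter fun k => .iInter fun hk => measurable_pi_apply k (hA k hk)

lemma measurableSet_fEv {B : Set S} (hB : MeasurableSet B) : MeasurableSet (FEv B) := by
  have : FEv B = ⋃ k, (fun ρ : ℕ → S => ρ k) ⁻¹' B := by
    ext ρ; simp [FEv]
  rw [this]
  exact .iUnion fun k => measurable_pi_apply k hB

/-- The cylinders over measurable sets. -/
def measurableCyls (S : Type*) [MeasurableSpace S] : Set (Set (ℕ → S)) :=
  {E | ∃ (A : ℕ → Set S) (n : ℕ), (∀ k, MeasurableSet (A k)) ∧ E = Cyl A n}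

lemma isPiSystem_measurableCyls : IsPiSystem (measurableCyls S) := by
  classical
  rintro _ ⟨A, n, hA, rfl⟩ _ ⟨A', n', hA', rfl⟩ -
  refine ⟨fun k => (if k < n then A k else univ) ∩ (if k < n' then A' k else univ), max n n',
    fun k => ?_, ?_⟩
  · refine MeasurableSet.inter ?_ ?_ <;> split_ifs <;> simp [hA, hA']
  · ext ρ
    constructor
    · rintro ⟨h, h'⟩ k -
      refine ⟨?_, ?_⟩
      · split_ifs with hk
        exacts [h k hk, mem_univ _]
      · split_ifs with hk
        exacts [h' k hk, mem_univ _]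
    · intro h
      refine ⟨fun k hk => ?_, fun k hk => ?_⟩
      · have := (h k (lt_max_of_lt_left hk)).1
        rwa [if_pos hk] at this
      · have := (h k (lt_max_of_lt_right hk)).2
        rwa [if_pos hk] at this

lemma generateFrom_measurableCyls :
    (inferInstance : MeasurableSpace (ℕ → S)) = MeasurableSpace.generateFrom (measurableCyls S) := by
  classical
  refine le_antisymm (iSup_le fun i => ?_) (MeasurableSpace.generateFrom_le ?_)
  · rintro _ ⟨s, hs, rfl⟩
    refine MeasurableSpace.measurableSet_generateFrom
      ⟨Function.update (fun _ => univ) i s, i + 1, fun k => ?_, ?_⟩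
    · by_cases hk : k = i
      · subst hk; simpa using hs
      · simp [hk]
    · ext ρ
      constructor
      · intro h k _
        by_cases hk : k = i
        · subst hk; simpa using h
        · simp [hk]
      · intro h
        simpa using h i (by omega)
  · rintro _ ⟨A, n, hA, rfl⟩
    exact measurableSet_cyl fun k _ => hA k

/-- The law of the run that starts in the given state. -/
noncomputable def runLaw (κ : Kernel S S) (P : Measure S → Measure (ℕ → S)) (s : S) :
    Measure (ℕ → S) :=
  (P (κ s)).map (prep s)

namespace IsPathMeasure

variable {κ : Kernel S S} {P : Measure S → Measure (ℕ → S)}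

lemma eq_bind_runLaw (hP : IsPathMeasure κ P) (μ : Measure S) [IsProbabilityMeasure μ] :
    P μ = μ.bind (runLaw κ P) :=
  hP.2 μ inferInstance

lemma aemeasurable_runLaw (hP : IsPathMeasure κ P) (μ : Measure S) [IsProbabilityMeasure μ] :
    AEMeasurable (runLaw κ P) μ := by
  by_contra h
  have := hP.1 μ inferInstance
  have h0 : P μ = 0 := by
    rw [hP.eq_bind_runLaw μ, Measure.bind, Measure.map_of_not_aemeasurable h, Measure.join_zero]
  exact IsProbabilityMeasure.ne_zero (P μ) h0

lemma apply_eq_lintegral (hP : IsPathMeasure κ P) (μ : Measure S) [IsProbabilityMeasure μ]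
    {E : Set (ℕ → S)} (hE : MeasurableSet E) : P μ E = ∫⁻ s, P (κ s) (prep s ⁻¹' E) ∂μ := by
  conv_lhs => rw [hP.eq_bind_runLaw μ]
  rw [Measure.bind_apply hE (hP.aemeasurable_runLaw μ)]
  exact lintegral_congr fun s => Measure.map_apply (measurable_prep_right s) hE

lemma exists_measurable_density (hP : IsPathMeasure κ P) [IsMarkovKernel κ] (n : ℕ) :
    ∀ A : ℕ → Set S, (∀ k, MeasurableSet (A k)) → ∃ g : S → ENNReal, Measurable g ∧
      ∀ μ : Measure S, IsProbabilityMeasure μ → P μ (Cyl A n) = ∫⁻ s, g s ∂μ := by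
  induction n with
  | zero =>
    refine fun A _ => ⟨1, measurable_const, fun μ hμ => ?_⟩
    have := hP.1 μ hμ
    simp [Cyl]
  | succ n ih =>
    intro A hA
    obtain ⟨g, hg, hgP⟩ := ih (fun k => A (k + 1)) fun k => hA _
    refine ⟨(A 0).indicator fun s => ∫⁻ t, g t ∂κ s, hg.lintegral_kernel.indicator (hA 0),
      fun μ hμ => ?_⟩
    rw [hP.apply_eq_lintegral μ (measurableSet_cyl fun k _ => hA k)]
    refine lintegral_congr fun s => ?_
    rw [prep_preimage_cyl_succ]
    by_cases hs : s ∈ A 0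
    · simp [hs, hgP (κ s) inferInstance]
    · simp [hs]

lemma isProbabilityMeasure_runLaw (hP : IsPathMeasure κ P) [IsMarkovKernel κ] (s : S) :
    IsProbabilityMeasure (runLaw κ P s) :=
  have := hP.1 (κ s) inferInstance
  Measure.isProbabilityMeasure_map (measurable_prep_right s).aemeasurable

lemma measurable_runLaw (hP : IsPathMeasure κ P) [IsMarkovKernel κ] :
    Measurable (runLaw κ P) := by
  have := hP.isProbabilityMeasure_runLaw
  refine Measurable.measure_of_isPiSystem_of_isProbabilityMeasure generateFrom_measurableCyls
    isPiSystem_measurableCyls ?_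
  rintro _ ⟨A, n, hA, rfl⟩
  cases n with
  | zero => simp [Cyl]
  | succ n =>
    obtain ⟨g, hg, hgP⟩ := hP.exists_measurable_density n (fun k => A (k + 1)) fun k => hA _
    have : (fun s => runLaw κ P s (Cyl A (n + 1)))
        = (A 0).indicator fun s => ∫⁻ t, g t ∂κ s := by
      ext s
      rw [runLaw, Measure.map_apply (measurable_prep_right s) (measurableSet_cyl fun k _ => hA k),
        prep_preimage_cyl_succ]
      by_cases hs : s ∈ A 0
      · simp [hs, hgP (κ s) inferInstance]
      · simp [hs]
    rw [this]
    exact hg.lintegral_kernel.indicator (hA 0)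

lemma apply_eq_lintegral_runLaw (hP : IsPathMeasure κ P) (μ : Measure S) [IsProbabilityMeasure μ]
    {E : Set (ℕ → S)} (hE : MeasurableSet E) : P μ E = ∫⁻ s, runLaw κ P s E ∂μ := by
  conv_lhs => rw [hP.eq_bind_runLaw μ]
  exact Measure.bind_apply hE (hP.aemeasurable_runLaw μ)

lemma lintegral_eq (hP : IsPathMeasure κ P) (μ : Measure S) [IsProbabilityMeasure μ]
    {φ : (ℕ → S) → ENNReal} (hφ : Measurable φ) :
    ∫⁻ ρ, φ ρ ∂P μ = ∫⁻ s, ∫⁻ ρ, φ (prep s ρ) ∂P (κ s) ∂μ := by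
  conv_lhs => rw [hP.eq_bind_runLaw μ]
  rw [Measure.lintegral_bind (hP.aemeasurable_runLaw μ) hφ.aemeasurable]
  exact lintegral_congr fun s => lintegral_map hφ (measurable_prep_right s)

/-- The **Markov property** at time `j`, in integrated form. -/
lemma measure_inter_shiftRun_preimage_eq_lintegral (hP : IsPathMeasure κ P) [IsMarkovKernel κ]
    {E : Set (ℕ → S)} (hE : MeasurableSet E) (j : ℕ) :
    ∀ (μ : Measure S) [IsProbabilityMeasure μ] {K : Set (ℕ → S)}, MeasurableSet K →
      DeterminedBy j K →
      P μ (K ∩ shiftRun j ⁻¹' E) = ∫⁻ ρ, K.indicator (fun ρ => runLaw κ P (ρ j) E) ρ ∂P μ := by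
  have hmeas : Measurable fun s => runLaw κ P s E :=
    (Measure.measurable_coe hE).comp hP.measurable_runLaw
  have hmeas' (i : ℕ) : Measurable fun ρ : ℕ → S => runLaw κ P (ρ i) E :=
    hmeas.comp (measurable_pi_apply i)
  induction j with
  | zero =>
    intro μ _ K hK hKj
    rw [hP.apply_eq_lintegral μ (hK.inter (measurable_shiftRun 0 hE)),
      hP.lintegral_eq μ ((hmeas' 0).indicator hK)]
    refine lintegral_congr fun s => ?_
    have := hP.1 (κ s) inferInstance
    have hconst : ∀ ρ ρ' : ℕ → S, prep s ρ ∈ K → prep s ρ' ∈ K := fun ρ ρ' =>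
      hKj _ _ fun i hi => by
        obtain rfl : i = 0 := by omega
        rfl
    by_cases h : ∃ ρ, prep s ρ ∈ K
    · obtain ⟨ρ₀, h₀⟩ := h
      have hK' : prep s ⁻¹' (K ∩ shiftRun 0 ⁻¹' E) = prep s ⁻¹' E := by
        ext ρ
        exact ⟨fun h => h.2, fun h => ⟨hconst _ _ h₀, h⟩⟩
      have hφ : ∀ ρ, K.indicator (fun ρ => runLaw κ P (ρ 0) E) (prep s ρ) = runLaw κ P s E :=
        fun ρ => indicator_of_mem (hconst _ _ h₀) _
      simp only [hφ, hK', lintegral_const, measure_univ, mul_one]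
      rw [runLaw, Measure.map_apply (measurable_prep_right s) hE]
    · push Not at h
      have hK' : prep s ⁻¹' (K ∩ shiftRun 0 ⁻¹' E) = ∅ := by
        ext ρ
        simp [h ρ]
      simp [hK', h]
  | succ j ih =>
    intro μ _ K hK hKj
    rw [hP.apply_eq_lintegral μ (hK.inter (measurable_shiftRun (j + 1) hE)),
      hP.lintegral_eq μ ((hmeas' (j + 1)).indicator hK)]
    exact lintegral_congr fun s =>
      ih (κ s) (measurable_prep_right s hK) (hKj.prep_preimage s)

/-- The **Markov property**: conditioned on an event determined by the states up to time `j`,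
the run from time `j` on follows the chain started in the conditional law of the state at
time `j`. -/
lemma measure_inter_shiftRun_preimage (hP : IsPathMeasure κ P) [IsMarkovKernel κ]
    (μ : Measure S) [IsProbabilityMeasure μ] {j : ℕ} {K : Set (ℕ → S)} (hK : MeasurableSet K)
    (hKj : DeterminedBy j K) (hK0 : P μ K ≠ 0) {E : Set (ℕ → S)} (hE : MeasurableSet E) :
    P μ (K ∩ shiftRun j ⁻¹' E)
      = P μ K * P ((ProbabilityTheory.cond (P μ) K).map fun ρ => ρ j) E := by
  have := hP.1 μ inferInstance
  have hcond : IsProbabilityMeasure (ProbabilityTheory.cond (P μ) K) :=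
    cond_isProbabilityMeasure hK0
  have hmap : IsProbabilityMeasure ((ProbabilityTheory.cond (P μ) K).map fun ρ => ρ j) :=
    Measure.isProbabilityMeasure_map (measurable_pi_apply j).aemeasurable
  have hmeas : Measurable fun s => runLaw κ P s E :=
    (Measure.measurable_coe hE).comp hP.measurable_runLaw
  rw [hP.measure_inter_shiftRun_preimage_eq_lintegral hE j μ hK hKj,
    hP.apply_eq_lintegral_runLaw _ hE, lintegral_map hmeas (measurable_pi_apply j),
    ProbabilityTheory.cond, lintegral_smul_measure, lintegral_indicator hK, smul_eq_mul,
    ← mul_assoc, ENNReal.mul_inv_cancel hK0 (measure_ne_top _ _), one_mul]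

/-- An occurrence of the pattern at time `j` is followed by a visit to `B` with conditional
probability at least `p`, whatever happened before time `j`. -/
lemma mul_measure_le_of_reach (hP : IsPathMeasure κ P) [IsMarkovKernel κ]
    {B : Set S} (hB : MeasurableSet B) {A : ℕ → Set S} {n : ℕ}
    (hA : ∀ k ≤ n, MeasurableSet (A k)) {p : ENNReal}
    (hreach : ∀ ν : Measure S, IsProbabilityMeasure ν → 0 < P ν (Cyl A (n + 1)) →
      p ≤ P (condDist P ν A n) (FEv B))
    (μ : Measure S) [IsProbabilityMeasure μ] {j : ℕ} {K : Set (ℕ → S)} (hK : MeasurableSet K)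
    (hKj : DeterminedBy j K) :
    p * P μ (K ∩ shiftRun j ⁻¹' Cyl A (n + 1))
      ≤ P μ (K ∩ shiftRun j ⁻¹' (Cyl A (n + 1) ∩ shiftRun n ⁻¹' FEv B)) := by
  have := hP.1 μ inferInstance
  have hC : MeasurableSet (Cyl A (n + 1)) := measurableSet_cyl fun k hk => hA k (by omega)
  have hF := measurableSet_fEv hB
  by_cases hK0 : P μ K = 0
  · rw [measure_mono_null inter_subset_left hK0, mul_zero]
    exact zero_le
  have hcond : IsProbabilityMeasure (ProbabilityTheory.cond (P μ) K) :=
    cond_isProbabilityMeasure hK0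
  have hmap : IsProbabilityMeasure ((ProbabilityTheory.cond (P μ) K).map fun ρ => ρ j) :=
    Measure.isProbabilityMeasure_map (measurable_pi_apply j).aemeasurable
  rw [hP.measure_inter_shiftRun_preimage μ hK hKj hK0 hC,
    hP.measure_inter_shiftRun_preimage μ hK hKj hK0 (hC.inter (measurable_shiftRun n hF))]
  set ν := (ProbabilityTheory.cond (P μ) K).map fun ρ => ρ j
  by_cases hν : P ν (Cyl A (n + 1)) = 0
  · simp [hν]
  rw [hP.measure_inter_shiftRun_preimage ν hC (determinedBy_cyl A n) hν hF, mul_left_comm,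
    mul_comm p]
  gcongr
  exact hreach ν hmap (pos_iff_ne_zero.2 hν)

/-- Along times `t 0, t 1, …` that are more than `n` apart, almost surely no run avoids `B` forever
while the pattern occurs at infinitely many of the times `t m`. -/
lemma measure_frequently_pattern_eq_zero (hP : IsPathMeasure κ P) [IsMarkovKernel κ]
    {B : Set S} (hB : MeasurableSet B) {A : ℕ → Set S} {n : ℕ}
    (hA : ∀ k ≤ n, MeasurableSet (A k)) {p : ENNReal} (hp : p ≠ 0)
    (hreach : ∀ ν : Measure S, IsProbabilityMeasure ν → 0 < P ν (Cyl A (n + 1)) →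
      p ≤ P (condDist P ν A n) (FEv B))
    (μ : Measure S) [IsProbabilityMeasure μ] {t : ℕ → ℕ} (ht : ∀ m, t m + n < t (m + 1)) :
    P μ (GEv Bᶜ ∩ {ρ | ∀ i, ∃ m ≥ i, shiftRun (t m) ρ ∈ Cyl A (n + 1)}) = 0 := by
  have := hP.1 μ inferInstance
  have hmono : StrictMono t := strictMono_nat_of_lt_succ fun m => by have := ht m; omega
  have hC : MeasurableSet (Cyl A (n + 1)) := measurableSet_cyl fun k hk => hA k (by omega)
  have hF := measurableSet_fEv hB
  set W := GEv Bᶜ ∩ {ρ | ∀ i, ∃ m ≥ i, shiftRun (t m) ρ ∈ Cyl A (n + 1)} with hW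
  let H : ℕ → Set (ℕ → S) := fun m => Cyl (fun _ => Bᶜ) (t m)
  have hH : ∀ m, MeasurableSet (H m) := fun m => measurableSet_cyl fun _ _ => hB.compl
  have key : ∀ m₀, p * P μ W ≤ P μ (H m₀ ∩ FEv B) := by
    intro m₀
    let K : ℕ → Set (ℕ → S) := fun k =>
      H m₀ ∩ ⋂ m, ⋂ (_ : m < k), (shiftRun (t (m₀ + m)) ⁻¹' Cyl A (n + 1))ᶜ
    have hK : ∀ k, MeasurableSet (K k) := fun k =>
      (hH m₀).inter (.iInter fun m => .iInter fun _ => (measurable_shiftRun _ hC).compl)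
    have hKdet : ∀ k, DeterminedBy (t (m₀ + k)) (K k) := by
      rintro k ρ ρ' h ⟨hρ, hρ'⟩
      refine ⟨fun i hi => ?_, ?_⟩
      · rw [← h i (hi.le.trans (hmono.monotone (by omega)))]
        exact hρ i hi
      · simp only [mem_iInter] at hρ' ⊢
        refine fun m hm hm' => hρ' m hm fun l hl => ?_
        have h1 := ht (m₀ + m)
        have h2 : t (m₀ + m + 1) ≤ t (m₀ + k) := hmono.monotone (by omega)
        have := hm' l hl
        simp only [shiftRun] at this ⊢
        rwa [h _ (by omega)]
    let Q : ℕ → Set (ℕ → S) := fun k => K k ∩ shiftRun (t (m₀ + k)) ⁻¹' Cyl A (n + 1)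
    let R : ℕ → Set (ℕ → S) := fun k =>
      K k ∩ shiftRun (t (m₀ + k)) ⁻¹' (Cyl A (n + 1) ∩ shiftRun n ⁻¹' FEv B)
    have hRm : ∀ k, MeasurableSet (R k) := fun k =>
      (hK k).inter (measurable_shiftRun _ (hC.inter (measurable_shiftRun n hF)))
    have hRd : Pairwise (Function.onFun Disjoint R) := by
      refine (pairwise_disjoint_on R).2 fun a b hab => ?_
      refine Set.disjoint_left.2 fun ρ ha hb => ?_
      have := hb.1.2
      simp only [mem_iInter] at this
      exact this a hab ha.2.1
    have hWQ : W ⊆ ⋃ k, Q k := by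
      classical
      rintro ρ ⟨hG, hi⟩
      have hex : ∃ k, shiftRun (t (m₀ + k)) ρ ∈ Cyl A (n + 1) := by
        obtain ⟨m, hm, h⟩ := hi m₀
        exact ⟨m - m₀, by rwa [Nat.add_sub_cancel' hm]⟩
      refine mem_iUnion.2 ⟨Nat.find hex, ⟨fun i _ => hG i, ?_⟩, Nat.find_spec hex⟩
      simp only [mem_iInter]
      exact fun m hm => Nat.find_min hex hm
    have hRF : ⋃ k, R k ⊆ H m₀ ∩ FEv B := by
      refine iUnion_subset fun k ρ hρ => ⟨hρ.1.1, ?_⟩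
      obtain ⟨i, hi⟩ := hρ.2.2
      exact ⟨_, hi⟩
    calc p * P μ W ≤ p * ∑' k, P μ (Q k) := by
          gcongr
          exact (measure_mono hWQ).trans (measure_iUnion_le _)
      _ = ∑' k, p * P μ (Q k) := ENNReal.tsum_mul_left.symm
      _ ≤ ∑' k, P μ (R k) := ENNReal.tsum_le_tsum fun k =>
          hP.mul_measure_le_of_reach hB hA hreach μ (hK k) (hKdet k)
      _ = P μ (⋃ k, R k) := (measure_iUnion hRd hRm).symm
      _ ≤ P μ (H m₀ ∩ FEv B) := measure_mono hRF
  have hempty : ⋂ m, H m ∩ FEv B = ∅ := by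
    refine eq_empty_of_forall_notMem fun ρ hρ => ?_
    rw [mem_iInter] at hρ
    obtain ⟨i, hi⟩ := (hρ 0).2
    exact (hρ (i + 1)).1 i ((hmono.id_le (i + 1)).trans_lt' (Nat.lt_succ_self i)) hi
  have hlim : Tendsto (fun m => P μ (H m ∩ FEv B)) atTop (𝓝 0) := by
    have h := tendsto_measure_iInter_atTop (μ := P μ) (s := fun m => H m ∩ FEv B)
      (fun m => ((hH m).inter hF).nullMeasurableSet)
      (fun a b hab => inter_subset_inter_left _ fun ρ hρ i hi =>
        hρ i (hi.trans_le (hmono.monotone hab)))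
      ⟨0, measure_ne_top _ _⟩
    rwa [hempty, measure_empty] at h
  have h0 : p * P μ W ≤ 0 := ge_of_tendsto' hlim key
  exact (mul_eq_zero.1 (le_antisymm h0 zero_le)).resolve_left hp

end IsPathMeasure

end PathMeasure

/-- Generalized version with a pattern `𝒜 = (A₀,…,Aₙ)`: if there is `p > 0` such that
`P_{ν_𝒜}(F B) ≥ p` for every initial distribution `ν` for which the conditional
distribution `ν_𝒜` is well-defined (i.e., `P_ν(Cyl 𝒜) > 0`), then for every initial
distribution `μ`, `P_μ(G (S∖B) ∩ GF φ_𝒜) = 0`. -/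
theorem no_avoid_B_forever_while_GF_pattern
    {S : Type*} [MeasurableSpace S] (κ : Kernel S S) [IsMarkovKernel κ]
    (P : Measure S → Measure (ℕ → S)) (hP : IsPathMeasure κ P)
    (B : Set S) (hB : MeasurableSet B)
    (A : ℕ → Set S) (n : ℕ) (hA : ∀ k ≤ n, MeasurableSet (A k))
    (p : ℝ) (hp : 0 < p)
    (hreach : ∀ ν : Measure S, IsProbabilityMeasure ν → 0 < P ν (Cyl A (n + 1)) →
      ENNReal.ofReal p ≤ P (condDist P ν A n) (FEv B)) :
    ∀ μ : Measure S, IsProbabilityMeasure μ → P μ (GEv Bᶜ ∩ GFPat A n) = 0 := by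
  intro μ hμ
  refine measure_mono_null (inter_subset_inter_right _ (gfPat_subset_iUnion A n)) ?_
  rw [inter_iUnion]
  refine measure_iUnion_null fun r => ?_
  exact hP.measure_frequently_pattern_eq_zero hB hA (ENNReal.ofReal_pos.2 hp).ne' hreach μ
    fun m => by rw [add_one_mul]; omega
end

section
/- Attractor-based decisiveness criterion: let (S, Σ, κ) be a stochastic transition system and B ∈ Σ. Suppose A ∈ Σ is an attractor and there exists a real number p > 0 such that every probability distribution ν on S with ν(A ∩ (S∖B̃)) = 1 satisfies P_ν(F B) ≥ p. Then the STS is decisive with respect to B. -/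
open MeasureTheory ProbabilityTheory Filter Set Topology

lemma measurable_prep_s7 {S : Type*} [MeasurableSpace S] (s : S) : Measurable (prep s) := by
  refine measurable_pi_lambda _ fun n => ?_
  cases n with
  | zero => exact measurable_const
  | succ n => exact measurable_pi_apply n

lemma measurableSet_FEv {S : Type*} [MeasurableSpace S] {B : Set S} (hB : MeasurableSet B) :
    MeasurableSet (FEv B) := by
  have h : FEv B = ⋃ n, (fun ρ : ℕ → S => ρ n) ⁻¹' B := by ext; simp [FEv]
  rw [h]
  exact .iUnion fun n => measurable_pi_apply n hB

lemma measurableSet_FleEv {S : Type*} [MeasurableSpace S] {B : Set S} (hB : MeasurableSet B)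
    (m : ℕ) : MeasurableSet (FleEv m B) := by
  have h : FleEv m B = ⋃ n, ⋃ (_ : n ≤ m), (fun ρ : ℕ → S => ρ n) ⁻¹' B := by
    ext; simp [FleEv]
  rw [h]
  exact .iUnion fun n => .iUnion fun _ => measurable_pi_apply n hB

lemma measurableSet_Cyl {S : Type*} [MeasurableSpace S] {A : ℕ → Set S}
    (hA : ∀ n, MeasurableSet (A n)) (m : ℕ) : MeasurableSet (Cyl A m) := by
  have h : Cyl A m = ⋂ n, ⋂ (_ : n < m), (fun ρ : ℕ → S => ρ n) ⁻¹' A n := by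
    ext; simp [Cyl]
  rw [h]
  exact .iInter fun n => .iInter fun _ => measurable_pi_apply n (hA n)

lemma FEv_compl_eq_iInter_Cyl {S : Type*} (B : Set S) :
    (FEv B)ᶜ = ⋂ n, Cyl (fun _ => Bᶜ) n := by
  ext ρ
  simp only [FEv, Cyl, mem_compl_iff, mem_ofPred_eq, not_exists, mem_iInter]
  exact ⟨fun h _ k _ => h k, fun h k => h (k + 1) k k.lt_succ_self⟩

lemma FEv_eq_iUnion_FleEv {S : Type*} (B : Set S) : FEv B = ⋃ n, FleEv n B := by
  ext ρ
  simp only [FEv, FleEv, mem_ofPred_eq, mem_iUnion]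
  exact ⟨fun ⟨n, h⟩ => ⟨n, n, le_rfl, h⟩, fun ⟨_, n, _, h⟩ => ⟨n, h⟩⟩

lemma antitone_Cyl {S : Type*} (A : ℕ → Set S) : Antitone (Cyl A) :=
  fun _ _ h _ hρ k hk => hρ k (hk.trans_le h)

lemma monotone_FleEv {S : Type*} (B : Set S) : Monotone fun n => FleEv n B :=
  fun _ _ h _ ⟨n, hn, hB⟩ => ⟨n, hn.trans h, hB⟩

lemma prep_mem_FEv {S : Type*} {B : Set S} {s : S} {ρ : ℕ → S} :
    prep s ρ ∈ FEv B ↔ s ∈ B ∨ ρ ∈ FEv B := by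
  constructor
  · rintro ⟨n, hn⟩
    cases n with
    | zero => exact .inl hn
    | succ n => exact .inr ⟨n, hn⟩
  · rintro (h | ⟨n, hn⟩)
    · exact ⟨0, h⟩
    · exact ⟨n + 1, hn⟩

lemma prep_mem_FleEv_succ {S : Type*} {B : Set S} {s : S} {ρ : ℕ → S} {m : ℕ} :
    prep s ρ ∈ FleEv (m + 1) B ↔ s ∈ B ∨ ρ ∈ FleEv m B := by
  constructor
  · rintro ⟨n, hn, h⟩
    cases n with
    | zero => exact .inl h
    | succ n => exact .inr ⟨n, by omega, h⟩
  · rintro (h | ⟨n, hn, h⟩)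
    · exact ⟨0, by omega, h⟩
    · exact ⟨n + 1, by omega, h⟩

lemma prep_mem_Cyl_succ {S : Type*} {C : Set S} {s : S} {ρ : ℕ → S} {m : ℕ} :
    prep s ρ ∈ Cyl (fun _ => C) (m + 1) ↔ s ∈ C ∧ ρ ∈ Cyl (fun _ => C) m := by
  constructor
  · exact fun h => ⟨h 0 (by omega), fun k hk => h (k + 1) (by omega)⟩
  · rintro ⟨h0, h⟩ k hk
    cases k with
    | zero => exact h0
    | succ k => exact h k (by omega)

namespace IsPathMeasure

variable {S : Type*} [MeasurableSpace S] {κ : Kernel S S} {P : Measure S → Measure (ℕ → S)}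

lemma aemeasurable (hP : IsPathMeasure κ P) (μ : Measure S) [hμ : IsProbabilityMeasure μ] :
    AEMeasurable (fun s => (P (κ s)).map (prep s)) μ := by
  by_contra h
  have := hP.1 μ hμ
  have h1 : P μ univ = 1 := measure_univ
  rw [hP.2 μ hμ, Measure.bind, Measure.map_of_not_aemeasurable h, Measure.join_zero] at h1
  simp at h1

lemma apply (hP : IsPathMeasure κ P) (μ : Measure S) [hμ : IsProbabilityMeasure μ]
    {E : Set (ℕ → S)} (hE : MeasurableSet E) :
    P μ E = ∫⁻ s, P (κ s) (prep s ⁻¹' E) ∂μ := by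
  rw [hP.2 μ hμ, Measure.bind_apply hE (hP.aemeasurable μ)]
  exact lintegral_congr fun s => Measure.map_apply (measurable_prep_s7 s) hE

lemma dirac (hP : IsPathMeasure κ P) (s : S) :
    P (Measure.dirac s) = (P (κ s)).map (prep s) := by
  have h := hP.aemeasurable (Measure.dirac s)
  have hs : (P (κ s)).map (prep s) = h.mk _ s := by
    by_contra hne
    have h0 := h.ae_eq_mk
    rw [Filter.EventuallyEq, ae_iff] at h0
    have h1 := Measure.le_dirac_apply (a := s)
      (s := {a | ¬ (P (κ a)).map (prep a) = h.mk _ a})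
    rw [h0, indicator_of_mem (by exact hne)] at h1
    simp at h1
  rw [hP.2 _ inferInstance, hs, Measure.bind, Measure.map_congr h.ae_eq_mk]
  exact Measure.dirac_bind h.measurable_mk s

lemma dirac_apply (hP : IsPathMeasure κ P) (s : S) {E : Set (ℕ → S)} (hE : MeasurableSet E) :
    P (Measure.dirac s) E = P (κ s) (prep s ⁻¹' E) := by
  rw [hP.dirac, Measure.map_apply (measurable_prep_s7 s) hE]

lemma measure_Cyl_succ (hP : IsPathMeasure κ P) {C : Set S} (hC : MeasurableSet C)
    (μ : Measure S) [IsProbabilityMeasure μ] (n : ℕ) :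
    P μ (Cyl (fun _ => C) (n + 1)) =
      ∫⁻ s, C.indicator (fun s => P (κ s) (Cyl (fun _ => C) n)) s ∂μ := by
  rw [hP.apply μ (measurableSet_Cyl (fun _ => hC) _)]
  refine lintegral_congr fun s => ?_
  by_cases hs : s ∈ C
  · rw [indicator_of_mem hs]
    congr 1
    ext ρ
    simp [prep_mem_Cyl_succ, hs]
  · rw [indicator_of_notMem hs, ← measure_empty (μ := P (κ s))]
    congr 1
    ext ρ
    simp [prep_mem_Cyl_succ, hs]

lemma measure_FEv_compl (hP : IsPathMeasure κ P) {B : Set S} (hB : MeasurableSet B)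
    (μ : Measure S) [hμ : IsProbabilityMeasure μ] :
    P μ (FEv B)ᶜ = ⨅ n, P μ (Cyl (fun _ => Bᶜ) n) := by
  have := hP.1 μ hμ
  rw [FEv_compl_eq_iInter_Cyl]
  exact (antitone_Cyl _).measure_iInter
    (fun n => (measurableSet_Cyl (fun _ => hB.compl) n).nullMeasurableSet)
    ⟨0, measure_ne_top _ _⟩

variable [IsMarkovKernel κ]

lemma measurable_Cyl (hP : IsPathMeasure κ P) {C : Set S} (hC : MeasurableSet C) (n : ℕ) :
    Measurable fun s => P (κ s) (Cyl (fun _ => C) n) := by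
  induction n with
  | zero =>
    have h : ∀ s, P (κ s) (Cyl (fun _ => C) 0) = 1 := fun s => by
      have := hP.1 (κ s) inferInstance
      simp [Cyl]
    simp only [h]
    exact measurable_const
  | succ n ih =>
    simp only [hP.measure_Cyl_succ hC]
    exact (ih.indicator hC).lintegral_kernel

lemma measurableSet_Btilde (hP : IsPathMeasure κ P) {B : Set S} (hB : MeasurableSet B) :
    MeasurableSet (Btilde P B) := by
  have h : Btilde P B = Bᶜ ∩ {s | ⨅ n, P (κ s) (Cyl (fun _ => Bᶜ) n) = 1} := by
    ext s
    have := hP.1 (κ s) inferInstance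
    rw [mem_inter_iff, mem_ofPred_eq, ← hP.measure_FEv_compl hB,
      prob_compl_eq_one_iff (measurableSet_FEv hB), Btilde, mem_ofPred_eq,
      hP.dirac_apply s (measurableSet_FEv hB)]
    by_cases hs : s ∈ B
    · have h : prep s ⁻¹' FEv B = univ := by ext ρ; simp [prep_mem_FEv, hs]
      simp [h, hs]
    · have h : prep s ⁻¹' FEv B = FEv B := by ext ρ; simp [prep_mem_FEv, hs]
      simp [h, hs]
  rw [h]
  exact hB.compl.inter
    (Measurable.iInf (fun n => hP.measurable_Cyl hB.compl n) (measurableSet_singleton 1))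

/-- If an event avoiding `B` is preserved by deleting the first state and has probability at most
`α` from every initial distribution, then the factor `P μ (F B)ᶜ` can be gained. -/
lemma measure_le_mul_FEv_compl (hP : IsPathMeasure κ P) {B : Set S} (hB : MeasurableSet B)
    {E : Set (ℕ → S)} (hE : MeasurableSet E) (hEB : E ⊆ (FEv B)ᶜ)
    (hshift : ∀ s, prep s ⁻¹' E ⊆ E) {α : ENNReal} (hα : α ≠ ⊤)
    (hle : ∀ μ : Measure S, IsProbabilityMeasure μ → P μ E ≤ α)
    (μ : Measure S) [IsProbabilityMeasure μ] :
    P μ E ≤ α * P μ (FEv B)ᶜ := by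
  have key : ∀ n, ∀ μ : Measure S, IsProbabilityMeasure μ →
      P μ E ≤ α * P μ (Cyl (fun _ => Bᶜ) n) := by
    intro n
    induction n with
    | zero =>
      intro μ hμ
      have := hP.1 μ hμ
      simpa [Cyl] using hle μ hμ
    | succ n ih =>
      intro μ hμ
      rw [hP.apply μ hE, hP.measure_Cyl_succ hB.compl,
        ← lintegral_const_mul _ ((hP.measurable_Cyl hB.compl n).indicator hB.compl)]
      refine lintegral_mono fun s => ?_
      by_cases hs : s ∈ B
      · have h : prep s ⁻¹' E = ∅ :=
          eq_empty_of_forall_notMem fun ρ hρ => hEB hρ (prep_mem_FEv.2 (.inl hs))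
        simp [h]
      · simpa [hs] using (measure_mono (hshift s)).trans (ih (κ s) inferInstance)
  rw [hP.measure_FEv_compl hB, ENNReal.mul_iInf' (fun h => absurd h hα) fun _ => inferInstance]
  exact le_iInf fun n => key n μ inferInstance

/-- If `A` is reached almost surely, the probability of an event that is preserved by deleting the
first state is bounded by its supremum over the states of `A`. -/
lemma measure_le_of_attractor (hP : IsPathMeasure κ P) {A : Set S} (hA : MeasurableSet A)
    (hattr : ∀ μ : Measure S, IsProbabilityMeasure μ → P μ (FEv A) = 1)
    {E : Set (ℕ → S)} (hE : MeasurableSet E) (hshift : ∀ s, prep s ⁻¹' E ⊆ E) {β : ENNReal}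
    (hle : ∀ a ∈ A, P (Measure.dirac a) E ≤ β)
    (μ : Measure S) [hμ : IsProbabilityMeasure μ] : P μ E ≤ β := by
  have step : ∀ F : Set (ℕ → S), MeasurableSet F → F ⊆ E →
      (∀ s ∉ A, P (κ s) (prep s ⁻¹' F) ≤ β) →
      ∀ μ : Measure S, IsProbabilityMeasure μ → P μ F ≤ β := by
    intro F hF hFE h μ hμ
    rw [hP.apply μ hF]
    refine (lintegral_mono (g := fun _ => β) fun s => ?_).trans (by simp)
    by_cases hs : s ∈ A
    · refine (measure_mono (preimage_mono hFE)).trans ?_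
      rw [← hP.dirac_apply s hE]
      exact hle s hs
    · exact h s hs
  have key : ∀ n, ∀ μ : Measure S, IsProbabilityMeasure μ → P μ (E ∩ FleEv n A) ≤ β := by
    intro n
    induction n with
    | zero =>
      refine step _ (hE.inter (measurableSet_FleEv hA 0)) inter_subset_left fun s hs => ?_
      have h : prep s ⁻¹' (E ∩ FleEv 0 A) = ∅ := by
        refine eq_empty_of_forall_notMem fun ρ hρ => ?_
        obtain ⟨n, hn, h⟩ := hρ.2
        obtain rfl : n = 0 := by omega
        exact hs h
      simp [h]
    | succ n ih =>
      refine step _ (hE.inter (measurableSet_FleEv hA _)) inter_subset_left fun s hs => ?_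
      refine (measure_mono fun ρ hρ => ?_).trans (ih (κ s) inferInstance)
      exact ⟨hshift s hρ.1, (prep_mem_FleEv_succ.1 hρ.2).resolve_left hs⟩
  have := hP.1 μ hμ
  have hnull : P μ (FEv A)ᶜ = 0 := (prob_compl_eq_zero_iff (measurableSet_FEv hA)).2 (hattr μ hμ)
  rw [← measure_inter_add_sdiff E (measurableSet_FEv hA),
    measure_mono_null (s := E \ FEv A) (fun _ h => h.2) hnull, add_zero, FEv_eq_iUnion_FleEv, inter_iUnion,
    Monotone.measure_iUnion fun _ _ h => inter_subset_inter_right _ (monotone_FleEv A h)]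
  exact iSup_le fun n => key n μ hμ

end IsPathMeasure

/-- **Attractor-based decisiveness criterion.** If `A` is an attractor and there is
`p > 0` such that every probability distribution `ν` concentrated on `A ∩ (S ∖ B̃)`
satisfies `P_ν(F B) ≥ p`, then the STS is decisive with respect to `B`. -/
theorem attractor_decisiveness_criterion
    {S : Type*} [MeasurableSpace S] (κ : Kernel S S) [IsMarkovKernel κ]
    (P : Measure S → Measure (ℕ → S)) (hP : IsPathMeasure κ P)
    (B : Set S) (hB : MeasurableSet B)
    (A : Set S) (hA : MeasurableSet A)
    (hattr : ∀ μ : Measure S, IsProbabilityMeasure μ → P μ (FEv A) = 1)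
    (p : ℝ) (hp : 0 < p)
    (hreach : ∀ ν : Measure S, IsProbabilityMeasure ν →
      ν (A ∩ (Btilde P B)ᶜ) = 1 → ENNReal.ofReal p ≤ P ν (FEv B)) :
    Decisive P B := by
  have hBt := hP.measurableSet_Btilde hB
  have hU := (measurableSet_FEv hB).union (measurableSet_FEv hBt)
  set E : Set (ℕ → S) := (FEv B ∪ FEv (Btilde P B))ᶜ with hE_def
  have hE : MeasurableSet E := hU.compl
  have hshift : ∀ s, prep s ⁻¹' E ⊆ E := fun s ρ hρ h =>
    hρ (h.imp (fun h => prep_mem_FEv.2 (.inr h)) fun h => prep_mem_FEv.2 (.inr h))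
  set α : ENNReal := ⨆ (μ : Measure S) (_ : IsProbabilityMeasure μ), P μ E with hα_def
  have hle : ∀ μ : Measure S, IsProbabilityMeasure μ → P μ E ≤ α := fun μ hμ =>
    le_iSup₂ (f := fun (μ : Measure S) (_ : IsProbabilityMeasure μ) => P μ E) μ hμ
  have hα1 : α ≤ 1 := iSup₂_le fun μ hμ => by
    have := hP.1 μ hμ
    exact prob_le_one
  have hα : α ≠ ⊤ := ne_top_of_le_ne_top ENNReal.one_ne_top hα1
  have hstate : ∀ a ∈ A, P (Measure.dirac a) E ≤ α * (1 - ENNReal.ofReal p) := by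
    intro a ha
    by_cases hab : a ∈ Btilde P B
    · have h : prep a ⁻¹' E = ∅ :=
        eq_empty_of_forall_notMem fun ρ hρ => hρ (.inr (prep_mem_FEv.2 (.inl hab)))
      simp [hP.dirac_apply a hE, h]
    · refine (hP.measure_le_mul_FEv_compl hB hE (compl_subset_compl.2 subset_union_left) hshift
        hα hle _).trans ?_
      have := hP.1 (Measure.dirac a) inferInstance
      rw [prob_compl_eq_one_sub (measurableSet_FEv hB)]
      gcongr
      refine hreach _ inferInstance ?_
      rw [Measure.dirac_apply' _ (hA.inter hBt.compl), indicator_of_mem (show a ∈ A ∩ (Btilde P B)ᶜ from ⟨ha, hab⟩), Pi.one_apply]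
  have hcontr : α ≤ α * (1 - ENNReal.ofReal p) := iSup₂_le fun μ hμ =>
    hP.measure_le_of_attractor hA hattr hE hshift hstate μ
  have hα0 : α = 0 := by
    by_contra h0
    have hlt : 1 - ENNReal.ofReal p < 1 :=
      ENNReal.sub_lt_self ENNReal.one_ne_top one_ne_zero (by simpa using hp)
    have := ENNReal.mul_lt_mul_right h0 hα hlt
    rw [mul_one] at this
    exact absurd hcontr this.not_ge
  intro μ hμ
  have := hP.1 μ hμ
  rw [← prob_compl_eq_zero_iff hU]
  exact le_antisymm ((hle μ hμ).trans_eq hα0) zero_le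
end
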